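/- arXiv:1402.1554 — 8 statements merged into one kernel-verified Lean document; each statement's English description precedes it below -/
import Mathlib

section
/- Let ν and ν̃ be (Borel) measures on (0,∞) with finite and nonzero second moments κ = ∫₀^∞ y² ν(dy) < ∞ and κ̃ = ∫₀^∞ y² ν̃(dy) < ∞, and set β = √(κ̃/κ). If for every ω > 0 one has ∫₀^∞ (1 − cos(ωy)) ν̃(dy) = ∫₀^∞ (1 − cos(βωy)) ν(dy), then ν̃ equals the pushforward of ν under the map y ↦ βy (equivalently, ∫ g dν̃ = ∫ g(βy) ν(dy) for all bounded measurable g). -/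
open MeasureTheory

theorem restrict_Ioi_eq_self {μ : Measure ℝ} (h : μ (Set.Ioi (0 : ℝ))ᶜ = 0) :
    μ.restrict (Set.Ioi 0) = μ :=
  Measure.restrict_eq_self_of_ae_mem (mem_ae_iff.2 h)

/-- A finite measure on `(0, ∞)` is determined by its cosine transform. -/
theorem ext_of_integral_cos_eq {ρ₁ ρ₂ : Measure ℝ} [IsFiniteMeasure ρ₁] [IsFiniteMeasure ρ₂]
    (h₁ : ρ₁ (Set.Ioi (0 : ℝ))ᶜ = 0) (h₂ : ρ₂ (Set.Ioi (0 : ℝ))ᶜ = 0)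
    (h : ∀ ω : ℝ, ∫ y, Real.cos (ω * y) ∂ρ₁ = ∫ y, Real.cos (ω * y) ∂ρ₂) : ρ₁ = ρ₂ := by
  have charFun_symm (ρ : Measure ℝ) [IsFiniteMeasure ρ] (t : ℝ) :
      charFun (ρ + ρ.map (fun x => -1 * x)) t = ((2 * ∫ y, Real.cos (t * y) ∂ρ : ℝ) : ℂ) := by
    have h_exp (μ : Measure ℝ) [IsFiniteMeasure μ] :
        Integrable (fun x : ℝ => Complex.exp (t * x * Complex.I)) μ := by
      refine Integrable.of_bound (by fun_prop) 1 (.of_forall fun x => ?_)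
      rw [← Complex.ofReal_mul, Complex.norm_exp_ofReal_mul_I]
    have hre : (charFun ρ t).re = ∫ y, Real.cos (t * y) ∂ρ := by
      rw [charFun_apply_real]
      refine (integral_re (h_exp ρ)).symm.trans (integral_congr_ae (.of_forall fun x => ?_))
      simp only [RCLike.re_eq_complex_re]
      rw [← Complex.ofReal_mul, Complex.exp_ofReal_mul_I_re]
    have hadd : charFun (ρ + ρ.map (fun x => -1 * x)) t
        = charFun ρ t + charFun (ρ.map (fun x => -1 * x)) t := by
      simp only [charFun_apply_real]
      exact integral_add_measure (h_exp _) (h_exp _)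
    rw [hadd, charFun_map_mul, neg_one_mul, charFun_neg, Complex.add_conj, hre]
  have heq : ρ₁ + ρ₁.map (fun x => -1 * x) = ρ₂ + ρ₂.map (fun x => -1 * x) := by
    refine Measure.ext_of_charFun (funext fun t => ?_)
    rw [charFun_symm, charFun_symm, h]
  have restrict_symm (ρ : Measure ℝ) (hρ : ρ (Set.Ioi (0 : ℝ))ᶜ = 0) :
      (ρ + ρ.map (fun x => -1 * x)).restrict (Set.Ioi 0) = ρ := by
    rw [Measure.restrict_add, restrict_Ioi_eq_self hρ,
      Measure.restrict_eq_zero.2, add_zero]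
    rw [Measure.map_apply (by fun_prop) measurableSet_Ioi]
    refine measure_mono_null (fun x hx => ?_) hρ
    simp only [Set.mem_preimage, Set.mem_Ioi, Set.mem_compl_iff, not_lt] at hx ⊢
    linarith
  rw [← restrict_symm ρ₁ h₁, heq, restrict_symm ρ₂ h₂]

theorem integrable_one_sub_cos_mul {μ : Measure ℝ} (hμ : Integrable (fun y => y ^ 2) μ) (ω : ℝ) :
    Integrable (fun y => 1 - Real.cos (ω * y)) μ := by
  refine (hμ.const_mul (ω ^ 2 / 2)).mono' (by fun_prop) (.of_forall fun y => ?_)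
  rw [Real.norm_of_nonneg (sub_nonneg.2 (Real.cos_le_one _))]
  linarith [Real.one_sub_sq_div_two_le_cos (x := ω * y)]

/-- A measure on `(0, ∞)` with finite second moment is determined by the integrals of
`y ↦ 1 - cos (ω y)`. -/
theorem ext_of_integral_one_sub_cos_eq {μ₁ μ₂ : Measure ℝ}
    (h₁ : μ₁ (Set.Ioi (0 : ℝ))ᶜ = 0) (h₂ : μ₂ (Set.Ioi (0 : ℝ))ᶜ = 0)
    (hi₁ : Integrable (fun y => y ^ 2) μ₁) (hi₂ : Integrable (fun y => y ^ 2) μ₂)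
    (h : ∀ ω : ℝ, 0 < ω →
      ∫ y, (1 - Real.cos (ω * y)) ∂μ₁ = ∫ y, (1 - Real.cos (ω * y)) ∂μ₂) : μ₁ = μ₂ := by
  have h_all (ω : ℝ) :
      ∫ y, (1 - Real.cos (ω * y)) ∂μ₁ = ∫ y, (1 - Real.cos (ω * y)) ∂μ₂ := by
    rcases lt_trichotomy ω 0 with hω | rfl | hω
    · simpa [neg_mul, Real.cos_neg] using h (-ω) (neg_pos.2 hω)
    · simp
    · exact h ω hω
  let w (c y : ℝ) : ENNReal := ENNReal.ofReal (1 - Real.cos (c * y))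
  have hw (c : ℝ) : Measurable (w c) := by fun_prop
  have integral_cos (c ω : ℝ) (μ : Measure ℝ) (hμ : Integrable (fun y => y ^ 2) μ) :
      ∫ y, Real.cos (ω * y) ∂(μ.withDensity (w c)) =
        (1 / 2) * ∫ y, (1 - Real.cos ((ω + c) * y)) ∂μ
          + (1 / 2) * ∫ y, (1 - Real.cos ((ω - c) * y)) ∂μ
          - ∫ y, (1 - Real.cos (ω * y)) ∂μ := by
    rw [integral_withDensity_eq_integral_toReal_smul (hw c)
      (.of_forall fun _ => ENNReal.ofReal_lt_top), ← integral_const_mul, ← integral_const_mul,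
      ← integral_add, ← integral_sub]
    · refine integral_congr_ae (.of_forall fun y => ?_)
      simp only [w, smul_eq_mul]
      rw [ENNReal.toReal_ofReal (sub_nonneg.2 (Real.cos_le_one _)), add_mul ω c y, sub_mul ω c y,
        Real.cos_add, Real.cos_sub]
      ring
    · exact ((integrable_one_sub_cos_mul hμ _).const_mul _).add
        ((integrable_one_sub_cos_mul hμ _).const_mul _)
    · exact integrable_one_sub_cos_mul hμ _
    · exact (integrable_one_sub_cos_mul hμ _).const_mul _
    · exact (integrable_one_sub_cos_mul hμ _).const_mul _
  have h_density (c : ℝ) : μ₁.withDensity (w c) = μ₂.withDensity (w c) := by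
    have := isFiniteMeasure_withDensity_ofReal (integrable_one_sub_cos_mul hi₁ c).2
    have := isFiniteMeasure_withDensity_ofReal (integrable_one_sub_cos_mul hi₂ c).2
    refine ext_of_integral_cos_eq (withDensity_absolutelyContinuous _ _ h₁)
      (withDensity_absolutelyContinuous _ _ h₂) fun ω => ?_
    rw [integral_cos c ω μ₁ hi₁, integral_cos c ω μ₂ hi₂, h_all, h_all, h_all]
  have h_restrict (n : ℕ) :
      μ₁.restrict (Set.Ioc 0 (n + 1 : ℝ)) = μ₂.restrict (Set.Ioc 0 (n + 1 : ℝ)) := by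
    let f := w (1 / (n + 1 : ℝ))
    have hf_ne (μ : Measure ℝ) : ∀ᵐ y ∂(μ.restrict (Set.Ioc 0 (n + 1 : ℝ))), f y ≠ 0 := by
      filter_upwards [ae_restrict_mem measurableSet_Ioc] with y hy
      have hn : (0 : ℝ) < n + 1 := by positivity
      have hpos : 0 < 1 / (n + 1 : ℝ) * y := mul_pos (by positivity) hy.1
      have hle : 1 / (n + 1 : ℝ) * y ≤ 1 := by
        rw [one_div_mul_eq_div, div_le_one hn]
        exact hy.2
      have hcos := Real.cos_lt_cos_of_nonneg_of_le_pi le_rfl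
        (hle.trans (by linarith [Real.pi_gt_three])) hpos
      rw [Real.cos_zero] at hcos
      exact (ENNReal.ofReal_pos.2 (sub_pos.2 hcos)).ne'
    have recover (μ : Measure ℝ) : μ.restrict (Set.Ioc 0 (n + 1 : ℝ)) =
        ((μ.withDensity f).restrict (Set.Ioc 0 (n + 1 : ℝ))).withDensity f⁻¹ := by
      rw [restrict_withDensity measurableSet_Ioc]
      exact (withDensity_inv_same (hw _) (hf_ne μ)
        (.of_forall fun _ => ENNReal.ofReal_ne_top)).symm
    rw [recover μ₁, recover μ₂, h_density]
  have h_Ioi : (⋃ n : ℕ, Set.Ioc 0 (n + 1 : ℝ)) = Set.Ioi 0 := by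
    ext y
    simp only [Set.mem_iUnion, Set.mem_Ioc, Set.mem_Ioi, exists_and_left, and_iff_left_iff_imp]
    intro _
    obtain ⟨n, hn⟩ := exists_nat_ge y
    exact ⟨n, hn.trans (by linarith)⟩
  rw [← restrict_Ioi_eq_self h₁, ← restrict_Ioi_eq_self h₂, ← h_Ioi]
  exact Measure.restrict_iUnion_congr.2 h_restrict

/-- If two measures on `(0, ∞)` with finite and nonzero second moments `κ` and `κ̃` satisfy
`∫₀^∞ (1 − cos(ωy)) ν̃(dy) = ∫₀^∞ (1 − cos(βωy)) ν(dy)` for all `ω > 0`, where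
`β = √(κ̃/κ)`, then `ν̃` is the pushforward of `ν` under `y ↦ βy`. -/
theorem stmt_0 (ν ν' : Measure ℝ)
    (hνc : ν (Set.Ioi (0 : ℝ))ᶜ = 0) (hν'c : ν' (Set.Ioi (0 : ℝ))ᶜ = 0)
    (hν2 : IntegrableOn (fun y => y ^ 2) (Set.Ioi 0) ν)
    (hν'2 : IntegrableOn (fun y => y ^ 2) (Set.Ioi 0) ν')
    (κ κ' β : ℝ)
    (hκ : κ = ∫ y in Set.Ioi (0 : ℝ), y ^ 2 ∂ν)
    (hκ' : κ' = ∫ y in Set.Ioi (0 : ℝ), y ^ 2 ∂ν')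
    (hκ0 : κ ≠ 0) (hκ'0 : κ' ≠ 0)
    (hβ : β = Real.sqrt (κ' / κ))
    (hEq : ∀ ω : ℝ, 0 < ω →
      (∫ y in Set.Ioi (0 : ℝ), (1 - Real.cos (ω * y)) ∂ν') =
        ∫ y in Set.Ioi (0 : ℝ), (1 - Real.cos (β * ω * y)) ∂ν) :
    ν' = ν.map (fun y => β * y) := by
  have hr := restrict_Ioi_eq_self hνc
  have hr' := restrict_Ioi_eq_self hν'c
  rw [IntegrableOn, hr] at hν2
  rw [IntegrableOn, hr'] at hν'2
  rw [hr] at hκ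
  rw [hr'] at hκ'
  simp only [hr, hr'] at hEq
  have hκ_pos : 0 < κ := lt_of_le_of_ne' (hκ ▸ integral_nonneg fun y => sq_nonneg y) hκ0
  have hκ'_pos : 0 < κ' := lt_of_le_of_ne' (hκ' ▸ integral_nonneg fun y => sq_nonneg y) hκ'0
  have hβ_pos : 0 < β := hβ ▸ Real.sqrt_pos.2 (div_pos hκ'_pos hκ_pos)
  have hm : Measurable (fun y : ℝ => β * y) := by fun_prop
  refine ext_of_integral_one_sub_cos_eq hν'c ?_ hν'2 ?_ fun ω hω => ?_
  · rw [Measure.map_apply hm measurableSet_Ioi.compl]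
    refine measure_mono_null (fun y hy => ?_) hνc
    simpa [hβ_pos] using hy
  · rw [integrable_map_measure (by fun_prop) hm.aemeasurable]
    simpa only [Function.comp_def, mul_pow] using hν2.const_mul (β ^ 2)
  · rw [hEq ω hω, integral_map hm.aemeasurable (by fun_prop)]
    simp only [mul_left_comm ω β, mul_assoc]
end

section
/- Let ν be a Borel measure on (0,∞) with ∫₀^∞ y² ν(dy) < ∞, let φ : (0,∞) → ℝ be measurable with ∫₀^∞ y² e^{φ(y)} ν(dy) < ∞, and let σ > 0 and σ̃ > 0. Then lim_{v→∞} (1/v) ∫₀^∞ [ (1 − cos(y√(2v)/σ̃)) e^{φ(y)} − (1 − cos(y√(2v)/σ)) ] ν(dy) = 0, where the limit is taken as the real parameter v tends to +∞. -/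
open MeasureTheory

/-- The quotient `(1 - cos (y √(2v) / s)) / v` is nonnegative and bounded by `y² / s²`. -/
lemma one_sub_cos_div_bounds (y s : ℝ) {v : ℝ} (hv : 0 < v) :
    0 ≤ 1 / v * (1 - Real.cos (y * Real.sqrt (2 * v) / s)) ∧
      1 / v * (1 - Real.cos (y * Real.sqrt (2 * v) / s)) ≤ y ^ 2 / s ^ 2 := by
  refine ⟨mul_nonneg (by positivity) (sub_nonneg.2 (Real.cos_le_one _)), ?_⟩
  have h := Real.one_sub_sq_div_two_le_cos (x := y * Real.sqrt (2 * v) / s)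
  rw [div_pow, mul_pow, Real.sq_sqrt (by positivity)] at h
  calc 1 / v * (1 - Real.cos (y * Real.sqrt (2 * v) / s))
      ≤ 1 / v * (y ^ 2 * (2 * v) / s ^ 2 / 2) := by gcongr; linarith
    _ = y ^ 2 / s ^ 2 := by field_simp

/-- For fixed `y` and `s`, `(1 - cos (y √(2v) / s)) / v → 0` as `v → ∞`. -/
lemma tendsto_one_sub_cos_div (y s : ℝ) :
    Filter.Tendsto (fun v : ℝ => 1 / v * (1 - Real.cos (y * Real.sqrt (2 * v) / s)))
      Filter.atTop (nhds 0) := by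
  have h : Filter.Tendsto (fun v : ℝ => 1 / v * 2) Filter.atTop (nhds 0) := by
    simpa using (tendsto_inv_atTop_zero (𝕜 := ℝ)).mul_const 2
  refine squeeze_zero' ?_ ?_ h
  · filter_upwards [Filter.eventually_gt_atTop 0] with v hv
    exact (one_sub_cos_div_bounds y s hv).1
  · filter_upwards [Filter.eventually_gt_atTop 0] with v hv
    gcongr
    linarith [Real.neg_one_le_cos (y * Real.sqrt (2 * v) / s)]

/-- Dominated-convergence lemma: for a measure `ν` on `(0,∞)` with finite second moment and
finite `e^φ`-weighted second moment, and `σ, σ̃ > 0`,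
`(1/v) ∫₀^∞ [(1 − cos(y√(2v)/σ̃)) e^{φ(y)} − (1 − cos(y√(2v)/σ))] ν(dy) → 0` as `v → ∞`. -/
theorem stmt_1 (ν : Measure ℝ) (φ : ℝ → ℝ) (hφ : Measurable φ)
    (σ σ' : ℝ) (hσ : 0 < σ) (hσ' : 0 < σ')
    (hν2 : ∫⁻ y in Set.Ioi (0 : ℝ), ENNReal.ofReal (y ^ 2) ∂ν ≠ ⊤)
    (hν2φ : ∫⁻ y in Set.Ioi (0 : ℝ), ENNReal.ofReal (y ^ 2 * Real.exp (φ y)) ∂ν ≠ ⊤) :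
    Filter.Tendsto
      (fun v : ℝ => (1 / v) *
        ∫ y in Set.Ioi (0 : ℝ),
          ((1 - Real.cos (y * Real.sqrt (2 * v) / σ')) * Real.exp (φ y)
            - (1 - Real.cos (y * Real.sqrt (2 * v) / σ))) ∂ν)
      Filter.atTop (nhds 0) := by
  have hi : Integrable (fun y : ℝ => y ^ 2) (ν.restrict (Set.Ioi 0)) :=
    (lintegral_ofReal_ne_top_iff_integrable (by fun_prop)
      (Filter.Eventually.of_forall fun y => sq_nonneg y)).1 hν2
  have hiφ : Integrable (fun y : ℝ => y ^ 2 * Real.exp (φ y)) (ν.restrict (Set.Ioi 0)) :=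
    (lintegral_ofReal_ne_top_iff_integrable
      (Measurable.aestronglyMeasurable (by fun_prop))
      (Filter.Eventually.of_forall fun y => by positivity)).1 hν2φ
  simp_rw [← integral_const_mul]
  rw [show nhds (0 : ℝ) = nhds (∫ _ in Set.Ioi (0 : ℝ), (0 : ℝ) ∂ν) by rw [integral_zero]]
  refine tendsto_integral_filter_of_dominated_convergence
    (fun y => y ^ 2 * Real.exp (φ y) / σ' ^ 2 + y ^ 2 / σ ^ 2) ?_ ?_
    ((hiφ.div_const _).add (hi.div_const _)) ?_
  · exact Filter.Eventually.of_forall fun v => Measurable.aestronglyMeasurable (by fun_prop)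
  · filter_upwards [Filter.eventually_gt_atTop 0] with v hv
    refine Filter.Eventually.of_forall fun y => ?_
    obtain ⟨h1, h2⟩ := one_sub_cos_div_bounds y σ' hv
    obtain ⟨h3, h4⟩ := one_sub_cos_div_bounds y σ hv
    rw [mul_sub, ← mul_assoc]
    refine (norm_sub_le _ _).trans (add_le_add ?_ ?_)
    · rw [Real.norm_of_nonneg (mul_nonneg h1 (Real.exp_nonneg _)),
        mul_div_right_comm (y ^ 2)]
      exact mul_le_mul_of_nonneg_right h2 (Real.exp_nonneg _)
    · rwa [Real.norm_of_nonneg h3]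
  · refine Filter.Eventually.of_forall fun y => ?_
    have h := ((tendsto_one_sub_cos_div y σ').mul_const (Real.exp (φ y))).sub
      (tendsto_one_sub_cos_div y σ)
    rw [zero_mul, sub_zero] at h
    exact h.congr fun v => by ring
end

section
/- Let ν be a Borel measure on (0,∞) with ∫₀^∞ y² ν(dy) < ∞, let φ : (0,∞) → ℝ be measurable with ∫₀^∞ y² e^{φ(y)} ν(dy) < ∞, let σ > 0, σ̃ > 0 and c ∈ ℝ. Suppose that for every v > 0, ∫₀^∞ [ (1 − cos(y√(2v)/σ̃)) e^{φ(y)} − (1 − cos(y√(2v)/σ)) ] ν(dy) + (c²v/2)(1/σ̃² − 1/σ²) = 0. Then c²(1/σ̃² − 1/σ²) = 0, and consequently for every v > 0, ∫₀^∞ [ (1 − cos(y√(2v)/σ̃)) e^{φ(y)} − (1 − cos(y√(2v)/σ)) ] ν(dy) = 0. -/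
open MeasureTheory

open Filter Topology

theorem one_sub_cos_mul_sqrt_le (y s : ℝ) {v : ℝ} (hv : 0 < v) :
    1 - Real.cos (y * Real.sqrt (2 * v) / s) ≤ v * (y ^ 2 / s ^ 2) := by
  have h := Real.one_sub_sq_div_two_le_cos (x := y * Real.sqrt (2 * v) / s)
  have e : (y * Real.sqrt (2 * v) / s) ^ 2 / 2 = v * (y ^ 2 / s ^ 2) := by
    rw [div_pow, mul_pow, Real.sq_sqrt (by positivity)]
    ring
  linarith

theorem tendsto_inv_mul_one_sub_cos (y s : ℝ) :
    Tendsto (fun v : ℝ => v⁻¹ * (1 - Real.cos (y * Real.sqrt (2 * v) / s))) atTop (𝓝 0) := by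
  refine tendsto_inv_atTop_zero.zero_mul_isBoundedUnder_le
    (isBoundedUnder_of ⟨2, fun v => ?_⟩)
  have h₁ := Real.neg_one_le_cos (y * Real.sqrt (2 * v) / s)
  have h₂ := Real.cos_le_one (y * Real.sqrt (2 * v) / s)
  simp only [Function.comp_apply, Real.norm_eq_abs, abs_le]
  constructor <;> linarith

theorem tendsto_inv_mul_integral_one_sub_cos (μ : Measure ℝ) {φ : ℝ → ℝ} (hφ : Measurable φ)
    (σ σ' : ℝ) (h : Integrable (fun y : ℝ => y ^ 2) μ)
    (h' : Integrable (fun y : ℝ => y ^ 2 * Real.exp (φ y)) μ) :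
    Tendsto (fun v : ℝ => v⁻¹ * ∫ y,
      ((1 - Real.cos (y * Real.sqrt (2 * v) / σ')) * Real.exp (φ y)
        - (1 - Real.cos (y * Real.sqrt (2 * v) / σ))) ∂μ) atTop (𝓝 0) := by
  simp_rw [← integral_const_mul]
  rw [← integral_zero ℝ ℝ (μ := μ)]
  refine tendsto_integral_filter_of_dominated_convergence
    (fun y => y ^ 2 * Real.exp (φ y) / σ' ^ 2 + y ^ 2 / σ ^ 2) ?_ ?_
    ((h'.div_const _).add (h.div_const _)) ?_
  · exact Eventually.of_forall fun v => Measurable.aestronglyMeasurable (by fun_prop)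
  · filter_upwards [eventually_gt_atTop 0] with v hv
    refine Eventually.of_forall fun y => ?_
    have a := one_sub_cos_mul_sqrt_le y σ hv
    have a' := mul_le_mul_of_nonneg_right (one_sub_cos_mul_sqrt_le y σ' hv) (Real.exp_pos (φ y)).le
    have b : 0 ≤ 1 - Real.cos (y * Real.sqrt (2 * v) / σ) := sub_nonneg.2 (Real.cos_le_one _)
    have b' : 0 ≤ (1 - Real.cos (y * Real.sqrt (2 * v) / σ')) * Real.exp (φ y) :=
      mul_nonneg (sub_nonneg.2 (Real.cos_le_one _)) (Real.exp_pos _).le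
    rw [norm_mul, norm_inv, Real.norm_of_nonneg hv.le, inv_mul_le_iff₀ hv, Real.norm_eq_abs]
    calc _ ≤ v * (y ^ 2 / σ' ^ 2) * Real.exp (φ y) + v * (y ^ 2 / σ ^ 2) := by
          rw [abs_le]
          constructor <;> linarith
      _ = _ := by ring
  · refine Eventually.of_forall fun y => ?_
    have h := ((tendsto_inv_mul_one_sub_cos y σ').mul_const (Real.exp (φ y))).sub
      (tendsto_inv_mul_one_sub_cos y σ)
    rw [zero_mul, sub_zero] at h
    exact h.congr fun v => by ring

/-- If for every `v > 0`,
`∫₀^∞ [(1 − cos(y√(2v)/σ̃)) e^{φ(y)} − (1 − cos(y√(2v)/σ))] ν(dy) + (c²v/2)(1/σ̃² − 1/σ²) = 0`,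
then `c²(1/σ̃² − 1/σ²) = 0` and the integral itself vanishes for every `v > 0`. -/
theorem stmt_2 (ν : Measure ℝ) (φ : ℝ → ℝ) (hφ : Measurable φ)
    (σ σ' c : ℝ) (hσ : 0 < σ) (hσ' : 0 < σ')
    (hν2 : ∫⁻ y in Set.Ioi (0 : ℝ), ENNReal.ofReal (y ^ 2) ∂ν ≠ ⊤)
    (hν2φ : ∫⁻ y in Set.Ioi (0 : ℝ), ENNReal.ofReal (y ^ 2 * Real.exp (φ y)) ∂ν ≠ ⊤)
    (hEq : ∀ v : ℝ, 0 < v →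
      (∫ y in Set.Ioi (0 : ℝ),
          ((1 - Real.cos (y * Real.sqrt (2 * v) / σ')) * Real.exp (φ y)
            - (1 - Real.cos (y * Real.sqrt (2 * v) / σ))) ∂ν)
        + c ^ 2 * v / 2 * (1 / σ' ^ 2 - 1 / σ ^ 2) = 0) :
    c ^ 2 * (1 / σ' ^ 2 - 1 / σ ^ 2) = 0 ∧
      ∀ v : ℝ, 0 < v →
        (∫ y in Set.Ioi (0 : ℝ),
            ((1 - Real.cos (y * Real.sqrt (2 * v) / σ')) * Real.exp (φ y)
              - (1 - Real.cos (y * Real.sqrt (2 * v) / σ))) ∂ν) = 0 := by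
  have h : Integrable (fun y : ℝ => y ^ 2) (ν.restrict (Set.Ioi 0)) :=
    (lintegral_ofReal_ne_top_iff_integrable (Measurable.aestronglyMeasurable (by fun_prop))
      (Eventually.of_forall fun y => sq_nonneg y)).1 hν2
  have h' : Integrable (fun y : ℝ => y ^ 2 * Real.exp (φ y)) (ν.restrict (Set.Ioi 0)) :=
    (lintegral_ofReal_ne_top_iff_integrable (Measurable.aestronglyMeasurable (by fun_prop))
      (Eventually.of_forall fun y => mul_nonneg (sq_nonneg y) (Real.exp_pos _).le)).1 hν2φ
  have hlim := tendsto_inv_mul_integral_one_sub_cos _ hφ σ σ' h h'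
  have hc : c ^ 2 * (1 / σ' ^ 2 - 1 / σ ^ 2) = 0 := by
    have hconst := hlim.congr' (f₂ := fun _ => -(c ^ 2 * (1 / σ' ^ 2 - 1 / σ ^ 2) / 2)) (by
      filter_upwards [eventually_gt_atTop 0] with v hv
      rw [eq_neg_of_add_eq_zero_left (hEq v hv)]
      field_simp)
    linarith [tendsto_nhds_unique hconst tendsto_const_nhds]
  refine ⟨hc, fun v hv => ?_⟩
  linear_combination hEq v hv - v / 2 * hc
end

section
/- Let ν and ν̃ be (Borel) measures on (0,∞) with finite second moments ∫₀^∞ y² ν(dy) < ∞ and ∫₀^∞ y² ν̃(dy) < ∞. If for every ω > 0 one has ∫₀^∞ (1 − cos(ωy)) ν̃(dy) = ∫₀^∞ (1 − cos(ωy)) ν(dy), then ν̃ = ν. -/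
open MeasureTheory

lemma integrable_exp_mul_I (μ : Measure ℝ) [IsFiniteMeasure μ] (t : ℝ) :
    Integrable (fun x : ℝ => Complex.exp (t * x * Complex.I)) μ := by
  refine (integrable_const (1 : ℝ)).mono' (by fun_prop) (ae_of_all _ fun x => ?_)
  rw [← Complex.ofReal_mul, Complex.norm_exp_ofReal_mul_I]

lemma charFun_add_measure (μ ρ : Measure ℝ) [IsFiniteMeasure μ] [IsFiniteMeasure ρ] (t : ℝ) :
    charFun (μ + ρ) t = charFun μ t + charFun ρ t := by
  simp only [charFun_apply_real]
  exact integral_add_measure (integrable_exp_mul_I μ t) (integrable_exp_mul_I ρ t)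

/-- The real part of the characteristic function is the cosine transform. -/
lemma re_charFun_eq_integral_cos (μ : Measure ℝ) [IsFiniteMeasure μ] (t : ℝ) :
    (charFun μ t).re = ∫ x, Real.cos (t * x) ∂μ := by
  rw [charFun_apply_real]
  refine (integral_re (𝕜 := ℂ) (integrable_exp_mul_I μ t)).symm.trans
    (integral_congr_ae (ae_of_all _ fun x => ?_))
  simp only [← Complex.ofReal_mul]
  exact Complex.exp_ofReal_mul_I_re _

/-- A finite measure on `(0,∞)` is determined by its cosine transform. -/
lemma ext_of_integral_cos {μ μ' : Measure ℝ} [IsFiniteMeasure μ] [IsFiniteMeasure μ']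
    (hμ : μ (Set.Ioi (0 : ℝ))ᶜ = 0) (hμ' : μ' (Set.Ioi (0 : ℝ))ᶜ = 0)
    (h : ∀ t : ℝ, ∫ x, Real.cos (t * x) ∂μ = ∫ x, Real.cos (t * x) ∂μ') : μ = μ' := by
  have charFun_symm (ρ : Measure ℝ) [IsFiniteMeasure ρ] (t : ℝ) :
      charFun (ρ + ρ.map (fun x => -1 * x)) t
        = ((2 * ∫ x, Real.cos (t * x) ∂ρ : ℝ) : ℂ) := by
    rw [charFun_add_measure, charFun_map_mul, neg_one_mul, charFun_neg, Complex.add_conj,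
      re_charFun_eq_integral_cos]
  have hsymm : μ + μ.map (fun x => -1 * x) = μ' + μ'.map (fun x => -1 * x) :=
    Measure.ext_of_charFun (funext fun t => by rw [charFun_symm, charFun_symm, h])
  have apply_symm {ρ : Measure ℝ} (hρ : ρ (Set.Ioi (0 : ℝ))ᶜ = 0) {s : Set ℝ}
      (hs : MeasurableSet s) :
      (ρ + ρ.map (fun x => -1 * x) : Measure ℝ) (s ∩ Set.Ioi 0) = ρ s := by
    have hneg : ρ ((fun x => -1 * x) ⁻¹' (s ∩ Set.Ioi 0)) = 0 := by
      refine measure_mono_null (fun x hx => ?_) hρ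
      have : 0 < -1 * x := hx.2
      simp only [Set.mem_compl_iff, Set.mem_Ioi]
      linarith
    rw [Measure.add_apply, Measure.map_apply (by fun_prop) (hs.inter measurableSet_Ioi),
      measure_inter_conull hρ, hneg, add_zero]
  ext s hs
  rw [← apply_symm hμ hs, ← apply_symm hμ' hs, hsymm]

lemma integrable_one_sub_cos {μ : Measure ℝ} (h : Integrable (fun y => y ^ 2) μ) (t : ℝ) :
    Integrable (fun y => 1 - Real.cos (t * y)) μ := by
  refine (h.const_mul (t ^ 2 / 2)).mono' (by fun_prop) (ae_of_all _ fun y => ?_)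
  rw [Real.norm_of_nonneg (sub_nonneg.2 (Real.cos_le_one _))]
  nlinarith [Real.one_sub_sq_div_two_le_cos (x := t * y)]

/-- Weighting by `1 - cos (a * y)` turns the cosine transform into a second difference. -/
lemma integral_one_sub_cos_mul_cos {μ : Measure ℝ} (h : Integrable (fun y => y ^ 2) μ)
    (a t : ℝ) :
    ∫ y, (1 - Real.cos (a * y)) * Real.cos (t * y) ∂μ =
      ((∫ y, (1 - Real.cos ((t + a) * y)) ∂μ) + ∫ y, (1 - Real.cos ((t - a) * y)) ∂μ) / 2
        - ∫ y, (1 - Real.cos (t * y)) ∂μ := by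
  have hi := integrable_one_sub_cos h
  rw [← integral_add (hi _) (hi _), ← integral_div,
    ← integral_sub (f := fun y => (1 - Real.cos ((t + a) * y) + (1 - Real.cos ((t - a) * y))) / 2)
      (((hi _).add (hi _)).div_const 2) (hi _)]
  refine integral_congr_ae (ae_of_all _ fun y => ?_)
  simp only [add_mul, sub_mul, Real.cos_add, Real.cos_sub]
  ring

/-- A weight that vanishes to second order at `0` and nowhere else. -/
noncomputable def cosWeight (y : ℝ) : ℝ :=
  (1 - Real.cos (1 * y)) + (1 - Real.cos (√2 * y))

lemma cosWeight_nonneg (y : ℝ) : 0 ≤ cosWeight y :=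
  add_nonneg (sub_nonneg.2 (Real.cos_le_one _)) (sub_nonneg.2 (Real.cos_le_one _))

lemma measurable_cosWeight : Measurable cosWeight := by
  unfold cosWeight
  fun_prop

lemma cosWeight_pos {y : ℝ} (hy : y ≠ 0) : 0 < cosWeight y := by
  refine (cosWeight_nonneg y).lt_of_ne' fun h0 => ?_
  have h1 := Real.cos_le_one (1 * y)
  have h2 := Real.cos_le_one (√2 * y)
  unfold cosWeight at h0
  obtain ⟨k, hk⟩ := (Real.cos_eq_one_iff _).1 (show Real.cos (1 * y) = 1 by linarith)
  obtain ⟨m, hm⟩ := (Real.cos_eq_one_iff _).1 (show Real.cos (√2 * y) = 1 by linarith)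
  rw [one_mul] at hk
  have hk0 : (k : ℝ) ≠ 0 := fun hk0 => hy (by rw [← hk, hk0, zero_mul])
  refine irrational_sqrt_two ⟨m / k, ?_⟩
  push_cast
  rw [div_eq_iff hk0]
  refine mul_right_cancel₀ Real.two_pi_pos.ne' ?_
  rw [hm, ← hk]
  ring

lemma integrable_cosWeight {μ : Measure ℝ} (h : Integrable (fun y => y ^ 2) μ) :
    Integrable cosWeight μ :=
  (integrable_one_sub_cos h 1).add (integrable_one_sub_cos h √2)

lemma integral_cos_withDensity_cosWeight {μ : Measure ℝ} (h : Integrable (fun y => y ^ 2) μ)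
    (t : ℝ) :
    ∫ y, Real.cos (t * y) ∂(μ.withDensity fun y => ENNReal.ofReal (cosWeight y)) =
      (∫ y, (1 - Real.cos (1 * y)) * Real.cos (t * y) ∂μ) +
        ∫ y, (1 - Real.cos (√2 * y)) * Real.cos (t * y) ∂μ := by
  have hi (a : ℝ) : Integrable (fun y => (1 - Real.cos (a * y)) * Real.cos (t * y)) μ :=
    (integrable_one_sub_cos h a).mul_bdd (c := 1) (by fun_prop)
      (ae_of_all _ fun y => Real.abs_cos_le_one _)
  rw [integral_withDensity_eq_integral_toReal_smul measurable_cosWeight.ennreal_ofReal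
    (ae_of_all _ fun _ => ENNReal.ofReal_lt_top), ← integral_add (hi _) (hi _)]
  refine integral_congr_ae (ae_of_all _ fun y => ?_)
  simp only [ENNReal.toReal_ofReal (cosWeight_nonneg y), smul_eq_mul]
  exact add_mul _ _ _

/-- If two measures on `(0,∞)` with finite second moments satisfy
`∫₀^∞ (1 − cos(ωy)) ν̃(dy) = ∫₀^∞ (1 − cos(ωy)) ν(dy)` for all `ω > 0`, then `ν̃ = ν`. -/
theorem stmt_3 (ν ν' : Measure ℝ)
    (hνc : ν (Set.Ioi (0 : ℝ))ᶜ = 0) (hν'c : ν' (Set.Ioi (0 : ℝ))ᶜ = 0)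
    (hν2 : IntegrableOn (fun y => y ^ 2) (Set.Ioi 0) ν)
    (hν'2 : IntegrableOn (fun y => y ^ 2) (Set.Ioi 0) ν')
    (hEq : ∀ ω : ℝ, 0 < ω →
      (∫ y in Set.Ioi (0 : ℝ), (1 - Real.cos (ω * y)) ∂ν') =
        ∫ y in Set.Ioi (0 : ℝ), (1 - Real.cos (ω * y)) ∂ν) :
    ν' = ν := by
  have restrict_Ioi {ρ : Measure ℝ} (hρ : ρ (Set.Ioi (0 : ℝ))ᶜ = 0) :
      ρ.restrict (Set.Ioi 0) = ρ := Measure.restrict_eq_self_of_ae_mem hρ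
  rw [IntegrableOn, restrict_Ioi hνc] at hν2
  rw [IntegrableOn, restrict_Ioi hν'c] at hν'2
  simp only [restrict_Ioi hνc, restrict_Ioi hν'c] at hEq
  have hEq' (ω : ℝ) :
      ∫ y, (1 - Real.cos (ω * y)) ∂ν' = ∫ y, (1 - Real.cos (ω * y)) ∂ν := by
    rcases lt_trichotomy ω 0 with h | rfl | h
    · simpa only [neg_mul, Real.cos_neg] using hEq (-ω) (neg_pos.2 h)
    · simp
    · exact hEq ω h
  let w : ℝ → ENNReal := fun y => ENNReal.ofReal (cosWeight y)
  have hw : Measurable w := measurable_cosWeight.ennreal_ofReal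
  have withDensity_inv {ρ : Measure ℝ} (hρ : ρ (Set.Ioi (0 : ℝ))ᶜ = 0) :
      (ρ.withDensity w).withDensity w⁻¹ = ρ := by
    refine withDensity_inv_same hw ?_ (ae_of_all _ fun _ => ENNReal.ofReal_ne_top)
    filter_upwards [show ∀ᵐ y ∂ρ, y ∈ Set.Ioi (0 : ℝ) from hρ] with y hy
    exact (ENNReal.ofReal_pos.2 (cosWeight_pos (ne_of_gt hy))).ne'
  have : IsFiniteMeasure (ν.withDensity w) :=
    isFiniteMeasure_withDensity_ofReal (integrable_cosWeight hν2).2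
  have : IsFiniteMeasure (ν'.withDensity w) :=
    isFiniteMeasure_withDensity_ofReal (integrable_cosWeight hν'2).2
  have hweighted : ν'.withDensity w = ν.withDensity w := by
    refine ext_of_integral_cos (withDensity_absolutelyContinuous _ _ hν'c)
      (withDensity_absolutelyContinuous _ _ hνc) fun t => ?_
    simp only [w, integral_cos_withDensity_cosWeight hν2, integral_cos_withDensity_cosWeight hν'2,
      integral_one_sub_cos_mul_cos hν2, integral_one_sub_cos_mul_cos hν'2, hEq']
  rw [← withDensity_inv hν'c, hweighted, withDensity_inv hνc]
end

section
/- Let m and m̃ be finite Borel measures on (0,∞). If for every λ > 0 one has ∫₀^∞ 1/(λ² + x²) m(dx) = ∫₀^∞ 1/(λ² + x²) m̃(dx), then m = m̃. -/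
open MeasureTheory

open Filter Topology BoundedContinuousFunction

/-- Finite measures on a Polish space are determined by the moments of an injective bounded
continuous function. -/
theorem ext_of_forall_integral_pow_eq {X : Type*} [TopologicalSpace X] [PolishSpace X]
    [MeasurableSpace X] [BorelSpace X] {P Q : Measure X} [IsFiniteMeasure P] [IsFiniteMeasure Q]
    (f : X →ᵇ ℝ) (hf : Function.Injective f)
    (h : ∀ n : ℕ, ∫ x, f x ^ n ∂P = ∫ x, f x ^ n ∂Q) : P = Q := by
  let A : StarSubalgebra ℝ (X →ᵇ ℝ) :=
    { Algebra.adjoin ℝ {f} with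
      star_mem' := fun {a} ha => by
        have : star a = a := by ext x; simp
        rw [this]; exact ha }
  refine ext_of_forall_mem_subalgebra_integral_eq_of_polish (𝕜 := ℝ) (A := A) ?_ ?_
  · intro x y hxy
    refine ⟨f, ⟨toContinuousMapStarₐ ℝ f, ⟨f, ?_, rfl⟩, rfl⟩, fun e => hxy (hf e)⟩
    exact Algebra.self_mem_adjoin_singleton ℝ f
  · intro g hg
    obtain ⟨p, rfl⟩ : ∃ p : Polynomial ℝ, Polynomial.aeval f p = g := by
      have hg' : g ∈ Algebra.adjoin ℝ {f} := hg
      rwa [Algebra.adjoin_singleton_eq_range_aeval] at hg'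
    clear hg
    induction p using Polynomial.induction_on' with
    | add p q hp hq =>
      simp only [map_add, BoundedContinuousFunction.coe_add, Pi.add_apply]
      rw [integral_add (BoundedContinuousFunction.integrable _ _)
          (BoundedContinuousFunction.integrable _ _),
        integral_add (BoundedContinuousFunction.integrable _ _)
          (BoundedContinuousFunction.integrable _ _), hp, hq]
    | monomial n a =>
      have key : ∀ x, (Polynomial.aeval f (Polynomial.monomial n a)) x = a * f x ^ n := by
        intro x
        simp [Polynomial.aeval_monomial, Algebra.algebraMap_eq_smul_one]
      simp only [key, integral_const_mul, h n]

theorem inv_one_add_sq_pow_mul_inv_le (n : ℕ) {s a : ℝ} (ha : 0 < a) (has : a ≤ s) (x : ℝ) :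
    ‖(1 + x ^ 2)⁻¹ ^ n * (s + x ^ 2)⁻¹‖ ≤ a⁻¹ := by
  have h1 : (1 + x ^ 2)⁻¹ ≤ 1 := inv_le_one_of_one_le₀ (by nlinarith [sq_nonneg x])
  have h2 : (s + x ^ 2)⁻¹ ≤ a⁻¹ := inv_anti₀ ha (by nlinarith [sq_nonneg x])
  have h0 : 0 < s := ha.trans_le has
  rw [Real.norm_of_nonneg (by positivity)]
  calc (1 + x ^ 2)⁻¹ ^ n * (s + x ^ 2)⁻¹ ≤ 1 * a⁻¹ := by
        gcongr
        exact pow_le_one₀ (by positivity) h1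
    _ = a⁻¹ := one_mul _

theorem integrable_inv_one_add_sq_pow_mul_inv (m : Measure ℝ) [IsFiniteMeasure m] (n : ℕ) {s : ℝ}
    (hs : 0 < s) : Integrable (fun x : ℝ => (1 + x ^ 2)⁻¹ ^ n * (s + x ^ 2)⁻¹) m :=
  .of_bound (by fun_prop) s⁻¹ (ae_of_all _ (inv_one_add_sq_pow_mul_inv_le n hs le_rfl))

theorem continuousAt_integral_inv_one_add_sq_pow_mul_inv (m : Measure ℝ) [IsFiniteMeasure m]
    (n : ℕ) {s : ℝ} (hs : 0 < s) :
    ContinuousAt (fun s : ℝ => ∫ x : ℝ, (1 + x ^ 2)⁻¹ ^ n * (s + x ^ 2)⁻¹ ∂m) s := by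
  refine tendsto_integral_filter_of_dominated_convergence (fun _ => (s / 2)⁻¹)
    (.of_forall fun _ => by fun_prop) ?_ (integrable_const _) ?_
  · filter_upwards [lt_mem_nhds (half_lt_self hs)] with t ht
    exact ae_of_all _ (inv_one_add_sq_pow_mul_inv_le n (half_pos hs) ht.le)
  · refine ae_of_all _ fun x => ContinuousAt.tendsto ?_
    have : s + x ^ 2 ≠ 0 := by positivity
    fun_prop (disch := assumption)

theorem tendsto_integral_mul_inv_add_sq (m : Measure ℝ) [IsFiniteMeasure m] :
    Tendsto (fun s : ℝ => ∫ x : ℝ, s * (s + x ^ 2)⁻¹ ∂m) atTop (𝓝 (∫ _, 1 ∂m)) := by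
  refine tendsto_integral_filter_of_dominated_convergence (fun _ => 1)
    (.of_forall fun _ => by fun_prop) ?_ (integrable_const _) ?_
  · filter_upwards [eventually_gt_atTop 0] with s hs
    refine ae_of_all _ fun x => ?_
    rw [Real.norm_of_nonneg (by positivity), ← div_eq_mul_inv]
    exact div_le_one_of_le₀ (by nlinarith [sq_nonneg x]) (by positivity)
  · refine ae_of_all _ fun x => ?_
    have h1 : Tendsto (fun s : ℝ => 1 - x ^ 2 * (s + x ^ 2)⁻¹) atTop (𝓝 (1 - x ^ 2 * 0)) :=
      ((tendsto_inv_atTop_zero.comp (tendsto_atTop_add_const_right _ _ tendsto_id)).const_mul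
        _).const_sub 1
    rw [mul_zero, sub_zero] at h1
    refine h1.congr' ?_
    filter_upwards [eventually_gt_atTop 0] with s hs
    field_simp
    ring

theorem integral_inv_one_add_sq_pow_mul_inv_eq {m m' : Measure ℝ} [IsFiniteMeasure m]
    [IsFiniteMeasure m']
    (h : ∀ s : ℝ, 0 < s → ∫ x : ℝ, (s + x ^ 2)⁻¹ ∂m = ∫ x : ℝ, (s + x ^ 2)⁻¹ ∂m') (n : ℕ) :
    ∀ s : ℝ, 0 < s → ∫ x : ℝ, (1 + x ^ 2)⁻¹ ^ n * (s + x ^ 2)⁻¹ ∂m =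
      ∫ x : ℝ, (1 + x ^ 2)⁻¹ ^ n * (s + x ^ 2)⁻¹ ∂m' := by
  induction n with
  | zero => simpa using h
  | succ n ih =>
    have resolvent : ∀ (μ : Measure ℝ) [IsFiniteMeasure μ] (s : ℝ), 0 < s → s ≠ 1 →
        ∫ x : ℝ, (1 + x ^ 2)⁻¹ ^ (n + 1) * (s + x ^ 2)⁻¹ ∂μ =
          (1 - s)⁻¹ * (∫ x : ℝ, (1 + x ^ 2)⁻¹ ^ n * (s + x ^ 2)⁻¹ ∂μ -
            ∫ x : ℝ, (1 + x ^ 2)⁻¹ ^ n * (1 + x ^ 2)⁻¹ ∂μ) := by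
      intro μ _ s hs hs1
      rw [← integral_sub (integrable_inv_one_add_sq_pow_mul_inv μ n hs)
        (integrable_inv_one_add_sq_pow_mul_inv μ n one_pos), ← integral_const_mul]
      congr 1 with x
      have h1 : 1 - s ≠ 0 := sub_ne_zero.2 hs1.symm
      have h2 : s + x ^ 2 ≠ 0 := by positivity
      have h3 : 1 + x ^ 2 ≠ 0 := by positivity
      have partial_fractions : (1 + x ^ 2)⁻¹ * (s + x ^ 2)⁻¹ =
          (1 - s)⁻¹ * ((s + x ^ 2)⁻¹ - (1 + x ^ 2)⁻¹) := by
        field_simp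
        ring
      rw [pow_succ, mul_assoc, partial_fractions]
      ring
    have ne_one : ∀ s : ℝ, 0 < s → s ≠ 1 →
        ∫ x : ℝ, (1 + x ^ 2)⁻¹ ^ (n + 1) * (s + x ^ 2)⁻¹ ∂m =
          ∫ x : ℝ, (1 + x ^ 2)⁻¹ ^ (n + 1) * (s + x ^ 2)⁻¹ ∂m' := fun s hs hs1 => by
      rw [resolvent m s hs hs1, resolvent m' s hs hs1, ih s hs, ih 1 one_pos]
    intro s hs
    rcases eq_or_ne s 1 with rfl | hs1
    · have hm := (continuousAt_integral_inv_one_add_sq_pow_mul_inv m (n + 1) hs).tendsto.mono_left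
        (nhdsWithin_le_nhds (s := {1}ᶜ))
      have hm' := (continuousAt_integral_inv_one_add_sq_pow_mul_inv m' (n + 1)
        hs).tendsto.mono_left (nhdsWithin_le_nhds (s := {1}ᶜ))
      refine tendsto_nhds_unique (hm.congr' ?_) hm'
      filter_upwards [self_mem_nhdsWithin, mem_nhdsWithin_of_mem_nhds (lt_mem_nhds hs)]
        with t ht ht0 using ne_one t ht0 ht
    · exact ne_one s hs hs1

theorem integral_inv_one_add_sq_pow_eq {m m' : Measure ℝ} [IsFiniteMeasure m]
    [IsFiniteMeasure m']
    (h : ∀ s : ℝ, 0 < s → ∫ x : ℝ, (s + x ^ 2)⁻¹ ∂m = ∫ x : ℝ, (s + x ^ 2)⁻¹ ∂m') (n : ℕ) :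
    ∫ x : ℝ, (1 + x ^ 2)⁻¹ ^ n ∂m = ∫ x : ℝ, (1 + x ^ 2)⁻¹ ^ n ∂m' := by
  cases n with
  | zero =>
    simp only [pow_zero]
    refine tendsto_nhds_unique ((tendsto_integral_mul_inv_add_sq m).congr' ?_)
      (tendsto_integral_mul_inv_add_sq m')
    filter_upwards [eventually_gt_atTop 0] with s hs
    simp only [integral_const_mul, h s hs]
  | succ n =>
    simp only [pow_succ]
    exact integral_inv_one_add_sq_pow_mul_inv_eq h n 1 one_pos

/-- Two finite Borel measures on `(0,∞)` with the same Stieltjes-type transform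
`λ ↦ ∫₀^∞ 1/(λ² + x²) dm` for all `λ > 0` are equal. -/
theorem stmt_4 (m m' : Measure ℝ) [IsFiniteMeasure m] [IsFiniteMeasure m']
    (hmc : m (Set.Ioi (0 : ℝ))ᶜ = 0) (hm'c : m' (Set.Ioi (0 : ℝ))ᶜ = 0)
    (h : ∀ l : ℝ, 0 < l →
      (∫ x in Set.Ioi (0 : ℝ), 1 / (l ^ 2 + x ^ 2) ∂m) =
        ∫ x in Set.Ioi (0 : ℝ), 1 / (l ^ 2 + x ^ 2) ∂m') :
    m = m' := by
  have hs : MeasurableSet (Set.Ioi (0 : ℝ)) := measurableSet_Ioi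
  have moments : ∀ n : ℕ, ∫ x in Set.Ioi (0 : ℝ), (1 + x ^ 2)⁻¹ ^ n ∂m =
      ∫ x in Set.Ioi (0 : ℝ), (1 + x ^ 2)⁻¹ ^ n ∂m' :=
    integral_inv_one_add_sq_pow_eq fun s hs => by
      simpa [Real.sq_sqrt hs.le] using h (√s) (Real.sqrt_pos.2 hs)
  let f : Set.Ioi (0 : ℝ) →ᵇ ℝ := .ofNormedAddCommGroup (fun x => (1 + (x : ℝ) ^ 2)⁻¹)
    (Continuous.inv₀ (by fun_prop) fun x => by positivity) 1 fun x => by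
      rw [Real.norm_of_nonneg (by positivity)]
      exact inv_le_one_of_one_le₀ (by nlinarith [sq_nonneg (x : ℝ)])
  have hf : Function.Injective f := fun x y hxy => by
    have hsq : (x : ℝ) ^ 2 = (y : ℝ) ^ 2 := add_left_cancel (inv_injective hxy)
    exact Subtype.ext ((pow_left_inj₀ (le_of_lt x.2) (le_of_lt y.2) two_ne_zero).1 hsq)
  have : PolishSpace (Set.Ioi (0 : ℝ)) := isOpen_Ioi.polishSpace
  have hcomap : m.comap ((↑) : Set.Ioi (0 : ℝ) → ℝ) = m'.comap (↑) := by
    refine ext_of_forall_integral_pow_eq f hf fun n => ?_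
    have key : ∀ μ : Measure ℝ, ∫ x, f x ^ n ∂(μ.comap (↑)) =
        ∫ x in Set.Ioi (0 : ℝ), (1 + x ^ 2)⁻¹ ^ n ∂μ := fun μ =>
      integral_subtype_comap hs fun x : ℝ => (1 + x ^ 2)⁻¹ ^ n
    rw [key, key, moments n]
  have hrestrict : m.restrict (Set.Ioi 0) = m'.restrict (Set.Ioi 0) := by
    rw [← map_comap_subtype_coe hs m, hcomap, map_comap_subtype_coe hs m']
  have hm : ∀ᵐ x ∂m, x ∈ Set.Ioi (0 : ℝ) := mem_ae_iff.2 hmc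
  have hm' : ∀ᵐ x ∂m', x ∈ Set.Ioi (0 : ℝ) := mem_ae_iff.2 hm'c
  rwa [Measure.restrict_eq_self_of_ae_mem hm, Measure.restrict_eq_self_of_ae_mem hm'] at hrestrict
end

section
/- Let Q be a probability measure, Y a real random variable with E_Q[e^Y] = e^{rT} for reals r and T > 0, and let S₀ > 0, K > 0. Define the probability measure Q₁ by dQ₁/dQ = e^{Y − rT}. Then e^{−rT} E_Q[(S₀e^Y − K)⁺] = S₀ Q₁(S₀e^Y > K) − e^{−rT} K Q(S₀e^Y > K), where x⁺ = max(x,0). -/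
open MeasureTheory

/-- Change of numéraire: if `E_Q[e^Y] = e^{rT}` and `Q₁` has density `e^{Y−rT}` w.r.t. `Q`, then
`e^{−rT} E_Q[(S₀e^Y − K)⁺] = S₀ Q₁(S₀e^Y > K) − e^{−rT} K Q(S₀e^Y > K)`. -/
theorem stmt_10 {Ω : Type*} [MeasurableSpace Ω] (Q : Measure Ω) [IsProbabilityMeasure Q]
    (Y : Ω → ℝ) (hY : Measurable Y) (r T : ℝ) (hT : 0 < T)
    (hint : Integrable (fun ω => Real.exp (Y ω)) Q)
    (hmart : (∫ ω, Real.exp (Y ω) ∂Q) = Real.exp (r * T))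
    (S0 K : ℝ) (hS0 : 0 < S0) (hK : 0 < K)
    (Q1 : Measure Ω)
    (hQ1 : Q1 = Q.withDensity fun ω => ENNReal.ofReal (Real.exp (Y ω - r * T))) :
    Real.exp (-(r * T)) * ∫ ω, max (S0 * Real.exp (Y ω) - K) 0 ∂Q =
      S0 * (Q1 {ω | K < S0 * Real.exp (Y ω)}).toReal
        - Real.exp (-(r * T)) * K * (Q {ω | K < S0 * Real.exp (Y ω)}).toReal := by
  have hA : MeasurableSet {ω | K < S0 * Real.exp (Y ω)} :=
    measurableSet_lt measurable_const (by fun_prop)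
  set A := {ω | K < S0 * Real.exp (Y ω)}
  have hQ1A : (Q1 A).toReal = Real.exp (-(r * T)) * ∫ ω in A, Real.exp (Y ω) ∂Q := by
    rw [hQ1, withDensity_apply _ hA, ← integral_const_mul,
      ← integral_eq_lintegral_of_nonneg_ae (ae_of_all _ fun ω => (Real.exp_pos _).le)
        (by fun_prop)]
    congr 1 with ω
    rw [← Real.exp_add]
    ring_nf
  have hpayoff : ∫ ω, max (S0 * Real.exp (Y ω) - K) 0 ∂Q =
      ∫ ω in A, (S0 * Real.exp (Y ω) - K) ∂Q := by
    rw [← integral_indicator hA]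
    congr 1 with ω
    by_cases h : ω ∈ A
    · rw [Set.indicator_of_mem h, max_eq_left (sub_nonneg.2 (le_of_lt h))]
    · rw [Set.indicator_of_notMem h, max_eq_right (sub_nonpos.2 (not_lt.1 h))]
  rw [hpayoff, integral_sub (hint.const_mul S0).integrableOn (integrable_const K),
    integral_const_mul, setIntegral_const, hQ1A, smul_eq_mul, measureReal_def]
  ring
end

section
/- Let Q be a probability measure, Y a real random variable with E_Q[e^Y] = e^{rT} for reals r and T > 0, and let S₀ > 0, K > 0, σ > 0 and L ∈ ℝ. Define the probability measure Q₁ by dQ₁/dQ = e^{Y − rT}, and define F(y) = Q(Y ≤ σ√T y + (r − L)T). Assume: (i) F(−y) = 1 − F(y) for all y ∈ ℝ; and (ii) Q₁(Y ≤ σ√T y + (r + L)T) = F(y) for all y ∈ ℝ. Then e^{−rT} E_Q[(S₀e^Y − K)⁺] = S₀ F( (ln(S₀/K) + (r + L)T) / (σ√T) ) − e^{−rT} K F( (ln(S₀/K) + (r − L)T) / (σ√T) ). -/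
open MeasureTheory

/-- The European call payoff integrates to the unrestricted payoff minus its part on the
out-of-the-money event. -/
lemma integral_call_payoff {Ω : Type*} [MeasurableSpace Ω] (Q : Measure Ω)
    [IsProbabilityMeasure Q] {Y : Ω → ℝ} (hY : Measurable Y)
    (hint : Integrable (fun ω => Real.exp (Y ω)) Q) {S0 K : ℝ} (hS0 : 0 < S0) (hK : 0 < K) :
    ∫ ω, max (S0 * Real.exp (Y ω) - K) 0 ∂Q =
      S0 * ((∫ ω, Real.exp (Y ω) ∂Q) - ∫ ω in {ω | Y ω ≤ -Real.log (S0 / K)}, Real.exp (Y ω) ∂Q)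
        - K * (1 - (Q {ω | Y ω ≤ -Real.log (S0 / K)}).toReal) := by
  set A : Set Ω := {ω | Y ω ≤ -Real.log (S0 / K)} with hA
  have hAm : MeasurableSet A := measurableSet_le hY measurable_const
  have hmem (ω : Ω) : ω ∈ A ↔ S0 * Real.exp (Y ω) ≤ K := by
    rw [hA, Set.mem_ofPred_eq, ← Real.log_inv, inv_div, Real.le_log_iff_exp_le (by positivity),
      le_div_iff₀ hS0, mul_comm]
  have hpayoff : Integrable (fun ω => S0 * Real.exp (Y ω) - K) Q :=
    (hint.const_mul S0).sub (integrable_const K)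
  have hmax : (fun ω => max (S0 * Real.exp (Y ω) - K) 0) = fun ω =>
      (S0 * Real.exp (Y ω) - K) - A.indicator (fun ω => S0 * Real.exp (Y ω) - K) ω := by
    funext ω
    by_cases h : ω ∈ A
    · rw [Set.indicator_of_mem h, sub_self, max_eq_right (by linarith [(hmem ω).1 h])]
    · rw [Set.indicator_of_notMem h, sub_zero,
        max_eq_left (by linarith [not_le.1 (mt (hmem ω).2 h)])]
  rw [hmax, integral_sub hpayoff (hpayoff.indicator hAm), integral_indicator hAm,
    integral_sub (hint.const_mul S0) (integrable_const K),
    integral_sub (hint.const_mul S0).integrableOn (integrable_const K),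
    integral_const_mul, integral_const_mul]
  simp only [integral_const, Measure.real, Measure.restrict_apply_univ, measure_univ,
    ENNReal.toReal_one, smul_eq_mul]
  ring

/-- The mass of a set under an exponentially tilted measure. -/
lemma toReal_withDensity_exp_sub {Ω : Type*} [MeasurableSpace Ω] {Q : Measure Ω}
    {Y : Ω → ℝ} (hY : Measurable Y) (c : ℝ) {A : Set Ω} (hA : MeasurableSet A) :
    (Q.withDensity (fun ω => ENNReal.ofReal (Real.exp (Y ω - c))) A).toReal =
      Real.exp (-c) * ∫ ω in A, Real.exp (Y ω) ∂Q := by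
  rw [withDensity_apply _ hA, ← integral_const_mul, integral_eq_lintegral_of_nonneg_ae
    (Filter.Eventually.of_forall fun ω => by positivity) (by fun_prop)]
  simp only [← Real.exp_add, sub_eq_add_neg, add_comm (-c)]

/-- Black–Scholes type option pricing formula for symmetric Lévy returns with a Brownian
component: with `F(y) = Q(Y ≤ σ√T y + (r−L)T)` symmetric (`F(−y) = 1 − F(y)`) and
`Q₁(Y ≤ σ√T y + (r+L)T) = F(y)`, the price `e^{−rT} E_Q[(S₀e^Y − K)⁺]` equals
`S₀ F((ln(S₀/K) + (r+L)T)/(σ√T)) − e^{−rT} K F((ln(S₀/K) + (r−L)T)/(σ√T))`. -/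
theorem stmt_12 {Ω : Type*} [MeasurableSpace Ω] (Q : Measure Ω) [IsProbabilityMeasure Q]
    (Y : Ω → ℝ) (hY : Measurable Y) (r T : ℝ) (hT : 0 < T)
    (hint : Integrable (fun ω => Real.exp (Y ω)) Q)
    (hmart : (∫ ω, Real.exp (Y ω) ∂Q) = Real.exp (r * T))
    (S0 K σ L : ℝ) (hS0 : 0 < S0) (hK : 0 < K) (hσ : 0 < σ)
    (Q1 : Measure Ω)
    (hQ1 : Q1 = Q.withDensity fun ω => ENNReal.ofReal (Real.exp (Y ω - r * T)))
    (F : ℝ → ℝ)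
    (hF : ∀ y : ℝ, F y = (Q {ω | Y ω ≤ σ * Real.sqrt T * y + (r - L) * T}).toReal)
    (hFsym : ∀ y : ℝ, F (-y) = 1 - F y)
    (hF1 : ∀ y : ℝ, (Q1 {ω | Y ω ≤ σ * Real.sqrt T * y + (r + L) * T}).toReal = F y) :
    Real.exp (-(r * T)) * ∫ ω, max (S0 * Real.exp (Y ω) - K) 0 ∂Q =
      S0 * F ((Real.log (S0 / K) + (r + L) * T) / (σ * Real.sqrt T))
        - Real.exp (-(r * T)) * K *
            F ((Real.log (S0 / K) + (r - L) * T) / (σ * Real.sqrt T)) := by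
  have hs : σ * Real.sqrt T ≠ 0 := (mul_pos hσ (Real.sqrt_pos.2 hT)).ne'
  have hthreshold (m : ℝ) :
      σ * Real.sqrt T * (-((Real.log (S0 / K) + m) / (σ * Real.sqrt T))) + m =
        -Real.log (S0 / K) := by
    rw [mul_neg, mul_div_cancel₀ _ hs]
    ring
  have hQ := hF (-((Real.log (S0 / K) + (r - L) * T) / (σ * Real.sqrt T)))
  have hT1 := hF1 (-((Real.log (S0 / K) + (r + L) * T) / (σ * Real.sqrt T)))
  rw [hFsym, hthreshold] at hQ hT1
  rw [hQ1, toReal_withDensity_exp_sub hY _ (measurableSet_le hY measurable_const)] at hT1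
  rw [integral_call_payoff Q hY hint hS0 hK, hmart, ← hQ]
  have hexp : Real.exp (-(r * T)) * Real.exp (r * T) = 1 := by
    rw [← Real.exp_add, neg_add_cancel, Real.exp_zero]
  linear_combination S0 * hexp - S0 * hT1
end

section
/- Let λ > 0, t > 0, μ < r be reals, set σ̃² = 2λ(1 − e^{−(r−μ)/λ}) (so 0 < σ̃² < 2λ), and let Y be a real random variable such that for all s with |s| < √(2λ)/σ̃ one has E[e^{sY}] = e^{sμt} (1 − s²σ̃²/(2λ))^{−λt}. Let Q₁ be the probability measure obtained by exponential tilting: dQ₁/dP = e^Y / E[e^Y]. Then E_{Q₁}[Y] = μt + μ₁t and Var_{Q₁}(Y) = σ̃₁² t, where μ₁ = 2λ(e^{(r−μ)/λ} − 1) and σ̃₁² = 2λ(e^{(r−μ)/λ} − 1)(2e^{(r−μ)/λ} − 1). -/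
open MeasureTheory ProbabilityTheory

lemma hasDerivAt_linear_sub_log (b k c s : ℝ) (hs : s ^ 2 * c < 1) :
    HasDerivAt (fun x : ℝ => x * b - k * Real.log (1 - x ^ 2 * c))
      (b + k * (2 * s * c / (1 - s ^ 2 * c))) s := by
  have hne : 1 - s ^ 2 * c ≠ 0 := by linarith
  have h := ((hasDerivAt_id s).mul_const b).sub
    (((((hasDerivAt_pow 2 s).mul_const c).const_sub 1).log hne).const_mul k)
  refine h.congr_deriv ?_
  norm_num
  ring

lemma hasDerivAt_add_mul_div (b k c s : ℝ) (hs : s ^ 2 * c < 1) :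
    HasDerivAt (fun x : ℝ => b + k * (2 * x * c / (1 - x ^ 2 * c)))
      (k * ((2 * c * (1 - s ^ 2 * c) + (2 * s * c) ^ 2) / (1 - s ^ 2 * c) ^ 2)) s := by
  have hne : 1 - s ^ 2 * c ≠ 0 := by linarith
  have h := ((((((hasDerivAt_id s).const_mul 2).mul_const c).div
    (((hasDerivAt_pow 2 s).mul_const c).const_sub 1) hne).const_mul k).const_add b)
  refine h.congr_deriv ?_
  simp only [id_eq]
  push_cast
  ring


/-- Exponential tilt of the symmetric Bessel (symmetric Variance Gamma) distribution: if `Y` has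
mgf `s ↦ e^{sμt}(1 − s²σ̃²/(2λ))^{−λt}` for `|s| < √(2λ)/σ̃`, with
`σ̃² = 2λ(1 − e^{−(r−μ)/λ})`, and `Q₁` has density `e^Y/E[e^Y]` w.r.t. `P`, then
`E_{Q₁}[Y] = μt + μ₁t` and `Var_{Q₁}(Y) = σ̃₁²t` with `μ₁ = 2λ(e^{(r−μ)/λ} − 1)` and
`σ̃₁² = 2λ(e^{(r−μ)/λ} − 1)(2e^{(r−μ)/λ} − 1)`. -/
theorem stmt_15 {Ω : Type*} [MeasurableSpace Ω] (P : Measure Ω) [IsProbabilityMeasure P]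
    (Y : Ω → ℝ) (hY : Measurable Y) (l t μ r : ℝ) (hl : 0 < l) (ht : 0 < t) (hμ : μ < r)
    (σ2 : ℝ) (hσ2 : σ2 = 2 * l * (1 - Real.exp (-(r - μ) / l)))
    (hmgf : ∀ s : ℝ, |s| < Real.sqrt (2 * l) / Real.sqrt σ2 →
      Integrable (fun ω => Real.exp (s * Y ω)) P ∧
        (∫ ω, Real.exp (s * Y ω) ∂P) =
          Real.exp (s * μ * t) * (1 - s ^ 2 * σ2 / (2 * l)) ^ (-(l * t)))
    (Q1 : Measure Ω)
    (hQ1 : Q1 = P.withDensity fun ω =>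
      ENNReal.ofReal (Real.exp (Y ω) / ∫ ω', Real.exp (Y ω') ∂P)) :
    (∫ ω, Y ω ∂Q1) = μ * t + 2 * l * (Real.exp ((r - μ) / l) - 1) * t ∧
      variance Y Q1 =
        2 * l * (Real.exp ((r - μ) / l) - 1) * (2 * Real.exp ((r - μ) / l) - 1) * t := by
  set a := Real.exp (-(r - μ) / l) with ha
  have ha0 : 0 < a := Real.exp_pos _
  have ha1 : a < 1 := by
    rw [ha, Real.exp_lt_one_iff]
    exact div_neg_of_neg_of_pos (by linarith) hl
  have hE : Real.exp ((r - μ) / l) = a⁻¹ := by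
    rw [ha, ← Real.exp_neg]
    congr 1
    ring
  have hσ0 : 0 < σ2 := by
    rw [hσ2]
    exact mul_pos (by linarith) (by linarith)
  have hc : σ2 / (2 * l) = 1 - a := by
    rw [hσ2]
    field_simp
  have hdom : ∀ s : ℝ, s ^ 2 * (1 - a) < 1 → |s| < Real.sqrt (2 * l) / Real.sqrt σ2 := by
    intro s hs
    rw [← Real.sqrt_div (by linarith), Real.lt_sqrt (abs_nonneg s), sq_abs, lt_div_iff₀ hσ0]
    rw [← hc, ← mul_div_assoc, div_lt_one (by linarith)] at hs
    exact hs
  set U : Set ℝ := {s : ℝ | s ^ 2 * (1 - a) < 1}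
  have hUo : IsOpen U := isOpen_lt (by fun_prop) continuous_const
  have h1U : (1 : ℝ) ∈ U := by
    change (1 : ℝ) ^ 2 * (1 - a) < 1
    linarith
  have hint : (1 : ℝ) ∈ interior (integrableExpSet Y P) :=
    interior_maximal (fun s hs => (hmgf s (hdom s hs)).1) hUo h1U
  have hcgf : Set.EqOn (cgf Y P)
      (fun s => s * (μ * t) - (l * t) * Real.log (1 - s ^ 2 * (1 - a))) U := by
    intro s hs
    have hs' : s ^ 2 * (1 - a) < 1 := hs
    have hpos : 0 < 1 - s ^ 2 * (1 - a) := by linarith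
    simp only [cgf, mgf]
    rw [(hmgf s (hdom s hs)).2, mul_div_assoc, hc,
      Real.log_mul (Real.exp_pos _).ne' (Real.rpow_pos_of_pos hpos _).ne', Real.log_exp,
      Real.log_rpow hpos]
    ring
  have hderiv : Set.EqOn (deriv (cgf Y P))
      (fun s => μ * t + (l * t) * (2 * s * (1 - a) / (1 - s ^ 2 * (1 - a)))) U := by
    intro s hs
    rw [(hcgf.eventuallyEq_of_mem (hUo.mem_nhds hs)).deriv_eq]
    exact (hasDerivAt_linear_sub_log _ _ _ s hs).deriv
  have hQ : Q1 = P.tilted (fun ω => 1 * Y ω) := by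
    rw [hQ1, Measure.tilted]
    simp only [one_mul]
  rw [hQ, integral_tilted_mul_self hint, variance_tilted_mul hint, hE, iteratedDeriv_succ,
    iteratedDeriv_one, (hderiv.eventuallyEq_of_mem (hUo.mem_nhds h1U)).deriv_eq,
    (hasDerivAt_add_mul_div _ _ _ 1 h1U).deriv, hderiv h1U]
  have h1a : 1 - (1 : ℝ) ^ 2 * (1 - a) = a := by ring
  simp only [h1a]
  constructor
  · field_simp
  · field_simp
    ring
end
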